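/- arXiv:math/0104079 — 3 statements merged into one kernel-verified Lean document; each statement's English description precedes it below -/
import Mathlib

section
/- Let H₀, H₁, H₂ be finite-dimensional ℚ-vector spaces, each equipped with a polarizable Hodge structure of weight 1, given by subspaces Fᵢ ⊆ ℂ ⊗_ℚ Hᵢ with ℂ ⊗_ℚ Hᵢ = Fᵢ ⊕ σ(Fᵢ). Let u ∈ H₀ ⊗_ℚ H₁ be a Hodge class, i.e. the image of u in ℂ ⊗_ℚ (H₀ ⊗ H₁) ≅ (ℂ⊗H₀) ⊗_ℂ (ℂ⊗H₁) lies in F₀ ⊗ σ(F₁) ⊕ σ(F₀) ⊗ F₁, and for j = 1, …, r let v_j ∈ H₁ ⊗_ℚ H₂ be Hodge classes (image in (ℂ⊗H₁) ⊗_ℂ (ℂ⊗H₂) lying in F₁ ⊗ σ(F₂) ⊕ σ(F₁) ⊗ F₂). Then, inside H₀ ⊗_ℚ H₁ ⊗_ℚ H₂, the intersection of the subspace (ℚ·u) ⊗ H₂ = span_ℚ{u ⊗ x : x ∈ H₂} with the subspace H₀ ⊗ span_ℚ{v₁, …, v_r} = span_ℚ{y ⊗ v_j : y ∈ H₀, 1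 ≤ j ≤ r} is zero. -/
open TensorProduct

/-- Complex conjugation on `ℂ`, as a `ℚ`-linear map. -/
noncomputable def conjQ : ℂ →ₗ[ℚ] ℂ where
  toFun := starRingEnd ℂ
  map_add' := by simp
  map_smul' := by intro q z; simp [Rat.smul_def]

@[simp] lemma conjQ_apply (z : ℂ) : conjQ z = starRingEnd ℂ z := rfl

/-- The complex-conjugation involution `σ` of `ℂ ⊗_ℚ H`, determined by `z ⊗ h ↦ z̄ ⊗ h`,
as a `conj`-semilinear map. -/
noncomputable def sigmaQ (H : Type*) [AddCommGroup H] [Module ℚ H] :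
    (ℂ ⊗[ℚ] H) →ₛₗ[starRingEnd ℂ] (ℂ ⊗[ℚ] H) where
  toFun := TensorProduct.map conjQ LinearMap.id
  map_add' := by simp
  map_smul' := by
    intro c x
    induction x using TensorProduct.induction_on with
    | zero => simp
    | tmul z h => simp [TensorProduct.smul_tmul', smul_eq_mul, map_mul]
    | add x y hx hy => simp_all [smul_add]

/-- The canonical isomorphism `ℂ ⊗_ℚ (H ⊗_ℚ H') ≅ (ℂ ⊗_ℚ H) ⊗_ℂ (ℂ ⊗_ℚ H')`. -/
noncomputable def distribQ (H H' : Type*) [AddCommGroup H] [Module ℚ H]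
    [AddCommGroup H'] [Module ℚ H'] :
    (ℂ ⊗[ℚ] (H ⊗[ℚ] H')) ≃ₗ[ℂ] (ℂ ⊗[ℚ] H) ⊗[ℂ] (ℂ ⊗[ℚ] H') :=
  TensorProduct.AlgebraTensorModule.distribBaseChange ℚ ℂ H H'

/-- The subspace `A ⊗ B` of `M ⊗[ℂ] N`, for `ℂ`-subspaces `A ⊆ M`, `B ⊆ N`. -/
noncomputable def tensorSub {M N : Type*} [AddCommGroup M] [Module ℂ M]
    [AddCommGroup N] [Module ℂ N] (A : Submodule ℂ M) (B : Submodule ℂ N) :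
    Submodule ℂ (M ⊗[ℂ] N) :=
  Submodule.map₂ (TensorProduct.mk ℂ M N) A B

/-- `(H, F)` is a polarizable Hodge structure of weight 1: there is an alternating
`ℚ`-bilinear form `Q` on `H` whose `ℂ`-bilinear extension vanishes on `F × F` and is such
that `i·Q(x, σ(x))` is a positive real number for every nonzero `x ∈ F`. -/
def IsPolarizableWeightOne (H : Type*) [AddCommGroup H] [Module ℚ H]
    (F : Submodule ℂ (ℂ ⊗[ℚ] H)) : Prop :=
  ∃ Q : H →ₗ[ℚ] H →ₗ[ℚ] ℚ,
    (∀ x, Q x x = 0) ∧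
    (∀ x ∈ F, ∀ y ∈ F, LinearMap.BilinForm.baseChange ℂ Q x y = 0) ∧
    (∀ x ∈ F, x ≠ 0 → ∃ r : ℝ, 0 < r ∧
       Complex.I * LinearMap.BilinForm.baseChange ℂ Q x (sigmaQ H x) = (r : ℂ))

/-- Over a field, a pure tensor vanishes only if one of its factors does. -/
theorem eq_zero_or_eq_zero_of_tmul_eq_zero {K M N : Type*} [Field K] [AddCommGroup M] [Module K M]
    [AddCommGroup N] [Module K N] {m : M} {n : N} (h : m ⊗ₜ[K] n = 0) : m = 0 ∨ n = 0 := by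
  by_contra! hmn
  obtain ⟨f, hf⟩ : ∃ f : Module.Dual K M, f m ≠ 0 := by
    by_contra! hf
    exact hmn.1 ((Module.forall_dual_apply_eq_zero_iff K m).mp hf)
  have := congrArg (fun t => TensorProduct.lid K N (f.rTensor N t)) h
  simp [hf, hmn.2] at this

theorem sigmaQ_one_tmul {H : Type*} [AddCommGroup H] [Module ℚ H] (a : H) :
    sigmaQ H ((1 : ℂ) ⊗ₜ a) = (1 : ℂ) ⊗ₜ a := by
  simp [sigmaQ]

theorem sigmaQ_sigmaQ {H : Type*} [AddCommGroup H] [Module ℚ H] (x : ℂ ⊗[ℚ] H) :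
    sigmaQ H (sigmaQ H x) = x := by
  induction x using TensorProduct.induction_on with
  | zero => simp
  | tmul z h => simp [sigmaQ]
  | add x y hx hy => rw [map_add, map_add, hx, hy]

/-- A rational vector lying in `σ(F)` also lies in `F`. -/
theorem one_tmul_mem_of_mem_map_sigmaQ {H : Type*} [AddCommGroup H] [Module ℚ H]
    {F : Submodule ℂ (ℂ ⊗[ℚ] H)} {a : H}
    (ha : (1 : ℂ) ⊗ₜ a ∈ F.map (sigmaQ H)) : (1 : ℂ) ⊗ₜ a ∈ F := by
  obtain ⟨f, hf, hfa⟩ := ha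
  have : f = (1 : ℂ) ⊗ₜ a := by
    rw [← sigmaQ_one_tmul, ← hfa, sigmaQ_sigmaQ]
  exact this ▸ hf

/-- A Hodge structure of weight 1 has no nonzero rational vector in `σ(F)`. -/
theorem eq_zero_of_one_tmul_mem_map_sigmaQ {H : Type*} [AddCommGroup H] [Module ℚ H]
    {F : Submodule ℂ (ℂ ⊗[ℚ] H)} (hF : Disjoint F (F.map (sigmaQ H))) {a : H}
    (ha : (1 : ℂ) ⊗ₜ a ∈ F.map (sigmaQ H)) : a = 0 :=
  (Module.FaithfullyFlat.one_tmul_eq_zero_iff ℚ H (A := ℂ) a).mp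
    (Submodule.disjoint_def.mp hF _ (one_tmul_mem_of_mem_map_sigmaQ ha) ha)

/-- The rational Hodge classes in `H ⊗ H'`, for Hodge structures of weight 1 given by `F`, `F'`. -/
noncomputable def hodgeClasses {H H' : Type*} [AddCommGroup H] [Module ℚ H]
    [AddCommGroup H'] [Module ℚ H'] (F : Submodule ℂ (ℂ ⊗[ℚ] H)) (F' : Submodule ℂ (ℂ ⊗[ℚ] H')) :
    Submodule ℚ (H ⊗[ℚ] H') :=
  (((tensorSub F (F'.map (sigmaQ H')) ⊔ tensorSub (F.map (sigmaQ H)) F').comap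
    (distribQ H H').toLinearMap).restrictScalars ℚ).comap (TensorProduct.mk ℚ ℂ (H ⊗[ℚ] H') 1)

theorem mem_hodgeClasses {H H' : Type*} [AddCommGroup H] [Module ℚ H]
    [AddCommGroup H'] [Module ℚ H'] {F : Submodule ℂ (ℂ ⊗[ℚ] H)} {F' : Submodule ℂ (ℂ ⊗[ℚ] H')}
    {w : H ⊗[ℚ] H'} : w ∈ hodgeClasses F F' ↔ distribQ H H' ((1 : ℂ) ⊗ₜ w) ∈
      tensorSub F (F'.map (sigmaQ H')) ⊔ tensorSub (F.map (sigmaQ H)) F' :=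
  Iff.rfl

/-- A pure tensor of rational vectors is a Hodge class only if one of its factors vanishes. -/
theorem eq_zero_or_eq_zero_of_tmul_mem_hodgeClasses {H H' : Type*} [AddCommGroup H] [Module ℚ H]
    [AddCommGroup H'] [Module ℚ H'] {F : Submodule ℂ (ℂ ⊗[ℚ] H)} {F' : Submodule ℂ (ℂ ⊗[ℚ] H')}
    (hF : Disjoint F (F.map (sigmaQ H))) (hF' : Disjoint F' (F'.map (sigmaQ H')))
    {a : H} {x : H'} (h : a ⊗ₜ x ∈ hodgeClasses F F') : a = 0 ∨ x = 0 := by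
  let p := TensorProduct.map (F.map (sigmaQ H)).mkQ (F'.map (sigmaQ H')).mkQ
  have hker : tensorSub F (F'.map (sigmaQ H')) ⊔ tensorSub (F.map (sigmaQ H)) F' ≤
      LinearMap.ker p := by
    refine sup_le (Submodule.map₂_le.mpr fun m _ n hn => ?_)
      (Submodule.map₂_le.mpr fun m hm n _ => ?_)
    · rw [LinearMap.mem_ker, TensorProduct.mk_apply, TensorProduct.map_tmul,
        (F'.map (sigmaQ H')).mkQ_apply n, (Submodule.Quotient.mk_eq_zero _).mpr hn,
        TensorProduct.tmul_zero]
    · rw [LinearMap.mem_ker, TensorProduct.mk_apply, TensorProduct.map_tmul,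
        (F.map (sigmaQ H)).mkQ_apply m, (Submodule.Quotient.mk_eq_zero _).mpr hm,
        TensorProduct.zero_tmul]
  have h0 : (F.map (sigmaQ H)).mkQ ((1 : ℂ) ⊗ₜ a) ⊗ₜ[ℂ] (F'.map (sigmaQ H')).mkQ ((1 : ℂ) ⊗ₜ x) = 0 :=
    hker (mem_hodgeClasses.mp h)
  refine (eq_zero_or_eq_zero_of_tmul_eq_zero h0).imp (fun ha => ?_) (fun hx => ?_)
  · exact eq_zero_of_one_tmul_mem_map_sigmaQ hF ((Submodule.Quotient.mk_eq_zero _).mp ha)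
  · exact eq_zero_of_one_tmul_mem_map_sigmaQ hF' ((Submodule.Quotient.mk_eq_zero _).mp hx)

/-- Contraction of the first factor of `(M ⊗ N) ⊗ P` against a linear form. -/
noncomputable def contractFirst {K M N P : Type*} [Field K] [AddCommGroup M] [Module K M]
    [AddCommGroup N] [Module K N] [AddCommGroup P] [Module K P] (f : M →ₗ[K] K) :
    (M ⊗[K] N) ⊗[K] P →ₗ[K] N ⊗[K] P :=
  (TensorProduct.lid K (N ⊗[K] P)).toLinearMap ∘ₗ f.rTensor (N ⊗[K] P) ∘ₗ
    (TensorProduct.assoc K M N P).toLinearMap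

theorem contractFirst_tmul {K M N P : Type*} [Field K] [AddCommGroup M] [Module K M]
    [AddCommGroup N] [Module K N] [AddCommGroup P] [Module K P] (f : M →ₗ[K] K)
    (w : M ⊗[K] N) (x : P) :
    contractFirst f (w ⊗ₜ x) = TensorProduct.lid K N (f.rTensor N w) ⊗ₜ x := by
  induction w using TensorProduct.induction_on with
  | zero => simp
  | tmul m n => simp [contractFirst, TensorProduct.smul_tmul']
  | add w w' hw hw' => rw [TensorProduct.add_tmul, map_add, hw, hw', map_add, map_add,
      TensorProduct.add_tmul]

theorem contractFirst_assoc_symm_tmul {K M N P : Type*} [Field K] [AddCommGroup M] [Module K M]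
    [AddCommGroup N] [Module K N] [AddCommGroup P] [Module K P] (f : M →ₗ[K] K)
    (y : M) (t : N ⊗[K] P) :
    contractFirst f ((TensorProduct.assoc K M N P).symm (y ⊗ₜ t)) = f y • t := by
  simp [contractFirst]

/-- Lemma 2.7: for polarizable weight-1 `ℚ`-Hodge structures `H₀, H₁, H₂`, a Hodge class
`u` in `H₀ ⊗ H₁` and Hodge classes `v₁, …, v_r` in `H₁ ⊗ H₂`, the subspaces
`(ℚ·u) ⊗ H₂` and `H₀ ⊗ span{v₁, …, v_r}` of `H₀ ⊗ H₁ ⊗ H₂` intersect trivially. -/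
theorem hodge_lemma_rat
    (H₀ H₁ H₂ : Type*)
    [AddCommGroup H₀] [Module ℚ H₀] [FiniteDimensional ℚ H₀]
    [AddCommGroup H₁] [Module ℚ H₁] [FiniteDimensional ℚ H₁]
    [AddCommGroup H₂] [Module ℚ H₂] [FiniteDimensional ℚ H₂]
    (F₀ : Submodule ℂ (ℂ ⊗[ℚ] H₀)) (F₁ : Submodule ℂ (ℂ ⊗[ℚ] H₁))
    (F₂ : Submodule ℂ (ℂ ⊗[ℚ] H₂))
    (hd₀ : IsCompl F₀ (F₀.map (sigmaQ H₀)))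
    (hd₁ : IsCompl F₁ (F₁.map (sigmaQ H₁)))
    (hd₂ : IsCompl F₂ (F₂.map (sigmaQ H₂)))
    (hp₀ : IsPolarizableWeightOne H₀ F₀)
    (hp₁ : IsPolarizableWeightOne H₁ F₁)
    (hp₂ : IsPolarizableWeightOne H₂ F₂)
    (u : H₀ ⊗[ℚ] H₁)
    (hu : distribQ H₀ H₁ ((1 : ℂ) ⊗ₜ u) ∈
      tensorSub F₀ (F₁.map (sigmaQ H₁)) ⊔ tensorSub (F₀.map (sigmaQ H₀)) F₁)
    (r : ℕ) (v : Fin r → H₁ ⊗[ℚ] H₂)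
    (hv : ∀ j, distribQ H₁ H₂ ((1 : ℂ) ⊗ₜ v j) ∈
      tensorSub F₁ (F₂.map (sigmaQ H₂)) ⊔ tensorSub (F₁.map (sigmaQ H₁)) F₂) :
    Submodule.span ℚ {z : (H₀ ⊗[ℚ] H₁) ⊗[ℚ] H₂ | ∃ x : H₂, z = u ⊗ₜ x} ⊓
      Submodule.span ℚ {z : (H₀ ⊗[ℚ] H₁) ⊗[ℚ] H₂ | ∃ (y : H₀) (j : Fin r),
        z = (TensorProduct.assoc ℚ H₀ H₁ H₂).symm (y ⊗ₜ v j)} = ⊥ := by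
  rw [Submodule.eq_bot_iff]
  rintro z ⟨hz, hz'⟩
  obtain ⟨x, rfl⟩ : ∃ x : H₂, z = u ⊗ₜ x := by
    have hle : Submodule.span ℚ {z : (H₀ ⊗[ℚ] H₁) ⊗[ℚ] H₂ | ∃ x : H₂, z = u ⊗ₜ x} ≤
        LinearMap.range (TensorProduct.mk ℚ (H₀ ⊗[ℚ] H₁) H₂ u) :=
      Submodule.span_le.mpr fun _ ⟨x, hx⟩ => ⟨x, hx.symm⟩
    obtain ⟨x, hx⟩ := hle hz
    exact ⟨x, hx.symm⟩
  have hcontract (f : H₀ →ₗ[ℚ] ℚ) : contractFirst f (u ⊗ₜ x) ∈ hodgeClasses F₁ F₂ := by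
    have hle : Submodule.span ℚ {z : (H₀ ⊗[ℚ] H₁) ⊗[ℚ] H₂ | ∃ (y : H₀) (j : Fin r),
        z = (TensorProduct.assoc ℚ H₀ H₁ H₂).symm (y ⊗ₜ v j)} ≤
        (hodgeClasses F₁ F₂).comap (contractFirst f) := by
      refine Submodule.span_le.mpr ?_
      rintro _ ⟨y, j, rfl⟩
      rw [SetLike.mem_coe, Submodule.mem_comap, contractFirst_assoc_symm_tmul]
      exact Submodule.smul_mem _ _ (mem_hodgeClasses.mpr (hv j))
    exact hle hz'
  by_cases hx : x = 0
  · rw [hx, TensorProduct.tmul_zero]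
  let b := Module.finBasis ℚ H₀
  have hu0 : u = 0 := by
    apply (TensorProduct.equivFinsuppOfBasisLeft (N := H₁) b).injective
    ext i
    rw [map_zero, Finsupp.zero_apply, TensorProduct.equivFinsuppOfBasisLeft_apply]
    have h := hcontract (b.coord i)
    rw [contractFirst_tmul] at h
    exact (eq_zero_or_eq_zero_of_tmul_mem_hodgeClasses hd₁.disjoint hd₂.disjoint h).resolve_right hx
  rw [hu0, TensorProduct.zero_tmul]
end

section
/- Let V be a 2-dimensional ℂ-vector space with basis {e, f}. Let a, a′ ∈ ℂ be both nonzero, and set u = a·(e ⊗ f) + a′·(f ⊗ e) ∈ V ⊗_ℂ V. Then, inside V ⊗_ℂ V ⊗_ℂ V, the intersection of the subspace (ℂ·u) ⊗ V = {u ⊗ x : x ∈ V} with the subspace V ⊗ span_ℂ{e ⊗ f, f ⊗ e} is zero. -/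
open TensorProduct

namespace TensorProduct

variable {R M N P : Type*} [CommSemiring R] [AddCommMonoid M] [AddCommMonoid N]
  [AddCommMonoid P] [Module R M] [Module R N] [Module R P]

/-- The functional `φ ⊗ ψ ⊗ χ` kills `M ⊗ W` as soon as `ψ ⊗ χ` kills a set spanning `W`. -/
theorem dualDistrib_assoc_symm_tmul_eq_zero_of_mem_span
    (φ : Module.Dual R M) (ψ : Module.Dual R N) (χ : Module.Dual R P) {s : Set (N ⊗[R] P)}
    (hs : ∀ w ∈ s, dualDistrib R N P (ψ ⊗ₜ χ) w = 0)
    {z : (M ⊗[R] N) ⊗[R] P}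
    (hz : z ∈ Submodule.span R {z : (M ⊗[R] N) ⊗[R] P | ∃ (y : M) (w : N ⊗[R] P),
      w ∈ Submodule.span R s ∧ z = (TensorProduct.assoc R M N P).symm (y ⊗ₜ w)}) :
    dualDistrib R (M ⊗[R] N) P (dualDistrib R M N (φ ⊗ₜ ψ) ⊗ₜ χ) z = 0 := by
  have key (y : M) (w : N ⊗[R] P) :
      dualDistrib R (M ⊗[R] N) P (dualDistrib R M N (φ ⊗ₜ ψ) ⊗ₜ χ)
        ((TensorProduct.assoc R M N P).symm (y ⊗ₜ w)) =
      φ y * dualDistrib R N P (ψ ⊗ₜ χ) w := by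
    induction w with
    | zero => simp
    | tmul n p => simp [mul_assoc]
    | add w₁ w₂ h₁ h₂ => simp only [tmul_add, map_add, h₁, h₂, mul_add]
  have hker : Submodule.span R s ≤ LinearMap.ker (dualDistrib R N P (ψ ⊗ₜ χ)) :=
    Submodule.span_le.2 hs
  induction hz using Submodule.span_induction with
  | mem z hz =>
    obtain ⟨y, w, hw, rfl⟩ := hz
    rw [key, LinearMap.mem_ker.1 (hker hw), mul_zero]
  | zero => simp
  | add z₁ z₂ _ _ h₁ h₂ => rw [map_add, h₁, h₂, add_zero]
  | smul r z _ h => rw [map_smul, h, smul_zero]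

/-- The span of the tensors `m ⊗ n`, for a fixed `m`, consists of such tensors. -/
theorem exists_eq_tmul_of_mem_span {m : M} {z : M ⊗[R] N}
    (hz : z ∈ Submodule.span R {z : M ⊗[R] N | ∃ n : N, z = m ⊗ₜ n}) :
    ∃ n : N, z = m ⊗ₜ n := by
  have hle : Submodule.span R {z : M ⊗[R] N | ∃ n : N, z = m ⊗ₜ n} ≤
      LinearMap.range (mk R M N m) :=
    Submodule.span_le.2 fun _ ⟨n, hn⟩ => ⟨n, hn.symm⟩
  obtain ⟨n, rfl⟩ := hle hz
  exact ⟨n, rfl⟩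

end TensorProduct

/-- Let `V` be a 2-dimensional complex vector space with basis `{e, f}`, and let
`u = a·(e ⊗ f) + a′·(f ⊗ e)` with `a, a′` both nonzero.  Then, inside `V ⊗ V ⊗ V`,
the subspace `(ℂ·u) ⊗ V = {u ⊗ x : x ∈ V}` meets the subspace
`V ⊗ span{e ⊗ f, f ⊗ e}` trivially. -/
theorem tensor_core_lemma
    (V : Type*) [AddCommGroup V] [Module ℂ V]
    (e f : V)
    (hli : LinearIndependent ℂ ![e, f])
    (hspan : Submodule.span ℂ {e, f} = ⊤)
    (a a' : ℂ) (ha : a ≠ 0) (ha' : a' ≠ 0)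
    (u : V ⊗[ℂ] V) (hu : u = a • (e ⊗ₜ f) + a' • (f ⊗ₜ e)) :
    Submodule.span ℂ {z : (V ⊗[ℂ] V) ⊗[ℂ] V | ∃ x : V, z = u ⊗ₜ x} ⊓
      Submodule.span ℂ {z : (V ⊗[ℂ] V) ⊗[ℂ] V | ∃ (y : V) (w : V ⊗[ℂ] V),
        w ∈ Submodule.span ℂ {e ⊗ₜ f, f ⊗ₜ e} ∧
        z = (TensorProduct.assoc ℂ V V V).symm (y ⊗ₜ w)} = ⊥ := by
  let b : Module.Basis (Fin 2) ℂ V := Module.Basis.mk hli (by simp [Set.pair_comm f e, hspan])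
  have hb0 : b 0 = e := by simp [b]
  have hb1 : b 1 = f := by simp [b]
  have coord_e (i : Fin 2) : b.coord i e = if i = 0 then 1 else 0 := by
    rw [← hb0, Module.Basis.coord_apply, b.repr_self, Finsupp.single_apply]
    simp only [eq_comm]
  have coord_f (i : Fin 2) : b.coord i f = if i = 1 then 1 else 0 := by
    rw [← hb1, Module.Basis.coord_apply, b.repr_self, Finsupp.single_apply]
    simp only [eq_comm]
  rw [eq_bot_iff]
  rintro z ⟨hzu, hzw⟩
  obtain ⟨x, rfl⟩ := exists_eq_tmul_of_mem_span hzu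
  have vanish (i j : Fin 2) := dualDistrib_assoc_symm_tmul_eq_zero_of_mem_span
    (b.coord i) (b.coord j) (b.coord j)
    (by rintro w (rfl | rfl) <;> fin_cases j <;>
      simp only [dualDistrib_apply, coord_e, coord_f] <;> simp) hzw
  have hx0 : b.coord 0 x = 0 := by
    have h := vanish 1 0
    simp only [hu, dualDistrib_apply, map_add, map_smul, coord_e, coord_f] at h
    simpa [ha'] using h
  have hx1 : b.coord 1 x = 0 := by
    have h := vanish 0 1
    simp only [hu, dualDistrib_apply, map_add, map_smul, coord_e, coord_f] at h
    simpa [ha] using h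
  have hx : x = 0 := b.forall_coord_eq_zero_iff.1 (Fin.forall_fin_two.2 ⟨hx0, hx1⟩)
  simp [hx]
end

section
/- Let H₁ and H₂ be finite-dimensional ℚ-vector spaces, each equipped with a polarizable Hodge structure of weight 0, given by bigradings ℂ ⊗_ℚ Hᵢ = ⊕_{p∈ℤ} Hᵢ^{p,−p} with σ(Hᵢ^{p,−p}) = Hᵢ^{−p,p}. Assume that H₂ contains no nonzero rational vector of type (0,0), i.e. the only element of H₂ whose image in ℂ ⊗_ℚ H₂ lies in H₂^{0,0} is 0. Let u ∈ H₁ be a rational vector of type (0,0), let ε ∈ ℂ ⊗_ℚ H₂, let λ₁, …, λ_r ∈ ℂ, and let u₁, …, u_r ∈ H₁ ⊗_ℚ H₂ be rational vectors of type (0,0) for the induced bigrading on H₁ ⊗ H₂. If u ⊗ ε − Σ_{j=1}^r λ_j·u_j lies in F¹(ℂ ⊗ (H₁⊗H₂)) + 2πi·(H₁⊗H₂)_ℚ, then u ⊗ ε itself lies in F¹(ℂ ⊗ (H₁⊗H₂)) + 2πi·(H₁⊗H₂)_ℚ. -/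
open TensorProduct

/-- `(H, {H^{p,-p}})` is a polarizable Hodge structure of weight 0: there is a symmetric
`ℚ`-bilinear form `Q` on `H` whose `ℂ`-bilinear extension satisfies
`Q(H^{p,-p}, H^{p',-p'}) = 0` for `p + p' ≠ 0`, and is such that `(-1)^p·Q(x, σ(x))` is a
positive real number for every nonzero `x ∈ H^{p,-p}`. -/
def IsPolarizableWeightZero (H : Type*) [AddCommGroup H] [Module ℚ H]
    (P : ℤ → Submodule ℂ (ℂ ⊗[ℚ] H)) : Prop :=
  ∃ Q : H →ₗ[ℚ] H →ₗ[ℚ] ℚ,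
    (∀ x y, Q x y = Q y x) ∧
    (∀ p p' : ℤ, p + p' ≠ 0 → ∀ x ∈ P p, ∀ y ∈ P p',
      LinearMap.BilinForm.baseChange ℂ Q x y = 0) ∧
    (∀ p : ℤ, ∀ x ∈ P p, x ≠ 0 → ∃ r : ℝ, 0 < r ∧
      ((-1 : ℂ) ^ p) * LinearMap.BilinForm.baseChange ℂ Q x (sigmaQ H x) = (r : ℂ))

/-- Membership in `F¹(ℂ ⊗ (H₁⊗H₂)) + 2πi·(H₁⊗H₂)_ℚ`, computed inside
`(ℂ ⊗ H₁) ⊗_ℂ (ℂ ⊗ H₂)` via the canonical isomorphism:  here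
`F¹ = ⊕_{p ≥ 1} (H₁⊗H₂)^{p,-p}` with `(H₁⊗H₂)^{p,-p} = ⊕_q H₁^{q,-q} ⊗ H₂^{p-q,q-p}`,
and the lattice consists of the elements `2πi·(1 ⊗ w)` with `w ∈ H₁ ⊗_ℚ H₂`. -/
def MemF1PlusLattice (H₁ H₂ : Type*) [AddCommGroup H₁] [Module ℚ H₁]
    [AddCommGroup H₂] [Module ℚ H₂]
    (P₁ : ℤ → Submodule ℂ (ℂ ⊗[ℚ] H₁)) (P₂ : ℤ → Submodule ℂ (ℂ ⊗[ℚ] H₂))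
    (z : (ℂ ⊗[ℚ] H₁) ⊗[ℂ] (ℂ ⊗[ℚ] H₂)) : Prop :=
  ∃ x ∈ (⨆ p : ℤ, ⨆ _ : 1 ≤ p, ⨆ q : ℤ, tensorSub (P₁ q) (P₂ (p - q))),
    ∃ w : H₁ ⊗[ℚ] H₂,
      z = x + ((2 * (Real.pi : ℂ) * Complex.I)) • distribQ H₁ H₂ ((1 : ℂ) ⊗ₜ w)

/-- The contraction `M ⊗ N → N` of the first factor against a linear functional. -/
noncomputable def contractFst {R M : Type*} (N : Type*) [CommRing R]
    [AddCommGroup M] [Module R M] [AddCommGroup N] [Module R N] (f : M →ₗ[R] R) :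
    M ⊗[R] N →ₗ[R] N :=
  (TensorProduct.lid R N).toLinearMap ∘ₗ f.rTensor N

@[simp] lemma contractFst_tmul {R M N : Type*} [CommRing R]
    [AddCommGroup M] [Module R M] [AddCommGroup N] [Module R N] (f : M →ₗ[R] R) (m : M) (n : N) :
    contractFst N f (m ⊗ₜ n) = f m • n := by
  simp [contractFst]

lemma distribQ_one_tmul_tmul {H H' : Type*} [AddCommGroup H] [Module ℚ H]
    [AddCommGroup H'] [Module ℚ H'] (a : H) (b : H') :
    distribQ H H' ((1 : ℂ) ⊗ₜ (a ⊗ₜ b)) = ((1 : ℂ) ⊗ₜ a) ⊗ₜ ((1 : ℂ) ⊗ₜ b) := by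
  simp [distribQ]

lemma contractFst_distribQ {H H' : Type*} [AddCommGroup H] [Module ℚ H]
    [AddCommGroup H'] [Module ℚ H'] {f : (ℂ ⊗[ℚ] H) →ₗ[ℂ] ℂ} {g : H →ₗ[ℚ] ℚ}
    (hfg : ∀ h, f ((1 : ℂ) ⊗ₜ h) = g h) (w : H ⊗[ℚ] H') :
    contractFst (ℂ ⊗[ℚ] H') f (distribQ H H' ((1 : ℂ) ⊗ₜ w)) =
      (1 : ℂ) ⊗ₜ contractFst H' g w := by
  induction w using TensorProduct.induction_on with
  | zero => simp
  | tmul a b =>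
    rw [distribQ_one_tmul_tmul, contractFst_tmul, contractFst_tmul, hfg,
      TensorProduct.smul_tmul', TensorProduct.tmul_smul, TensorProduct.smul_tmul']
    simp [Rat.smul_def]
  | add x y hx hy => simp only [TensorProduct.tmul_add, map_add, hx, hy]

lemma tensorSub_le_comap_contractFst {M N : Type*} [AddCommGroup M] [Module ℂ M]
    [AddCommGroup N] [Module ℂ N] {P₁ : ℤ → Submodule ℂ M} {P₂ : ℤ → Submodule ℂ N}
    {f : M →ₗ[ℂ] ℂ} (hf : ∀ q ≠ 0, ∀ x ∈ P₁ q, f x = 0) (p : ℤ) :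
    (⨆ q : ℤ, tensorSub (P₁ q) (P₂ (p - q))) ≤ (P₂ p).comap (contractFst N f) := by
  refine iSup_le fun q => Submodule.map₂_le.2 fun m hm n hn => ?_
  rw [Submodule.mem_comap, TensorProduct.mk_apply, contractFst_tmul]
  by_cases hq : q = 0
  · subst hq
    exact (P₂ p).smul_mem _ (by simpa using hn)
  · simp [hf q hq m hm]

/-- A rational vector of type `(0,0)` in a polarized Hodge structure of weight 0 is split off
by a rational functional that vanishes on all components of nonzero degree. -/
lemma IsPolarizableWeightZero.exists_functional {H : Type*} [AddCommGroup H] [Module ℚ H]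
    {P : ℤ → Submodule ℂ (ℂ ⊗[ℚ] H)} (hpol : IsPolarizableWeightZero H P) {u : H}
    (hu : ((1 : ℂ) ⊗ₜ u : ℂ ⊗[ℚ] H) ∈ P 0) (hu0 : ((1 : ℂ) ⊗ₜ u : ℂ ⊗[ℚ] H) ≠ 0) :
    ∃ (f : (ℂ ⊗[ℚ] H) →ₗ[ℂ] ℂ) (g : H →ₗ[ℚ] ℚ), (∀ h, f ((1 : ℂ) ⊗ₜ h) = g h) ∧
      f ((1 : ℂ) ⊗ₜ u) = 1 ∧ ∀ q ≠ 0, ∀ x ∈ P q, f x = 0 := by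
  obtain ⟨Q, -, horth, hpos⟩ := hpol
  obtain ⟨r, hr, hQr⟩ := hpos 0 _ hu hu0
  have hσ : sigmaQ H ((1 : ℂ) ⊗ₜ u) = (1 : ℂ) ⊗ₜ u := by simp [sigmaQ]
  have hQ (h : H) : LinearMap.BilinForm.baseChange ℂ Q ((1 : ℂ) ⊗ₜ u) ((1 : ℂ) ⊗ₜ h) =
      (Q u h : ℂ) := by
    simp [LinearMap.BilinForm.baseChange_tmul, Rat.smul_def]
  have hne : (Q u u : ℂ) ≠ 0 := by
    rw [hσ, hQ, zpow_zero, one_mul] at hQr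
    rw [hQr]
    exact_mod_cast hr.ne'
  refine ⟨(Q u u : ℂ)⁻¹ • LinearMap.BilinForm.baseChange ℂ Q ((1 : ℂ) ⊗ₜ u),
    (Q u u)⁻¹ • Q u, fun h => ?_, ?_, fun q hq x hx => ?_⟩
  · simp [hQ]
  · simp [hQ, hne]
  · simp [horth 0 q (by simpa using hq) _ hu x hx]

/-- Lemma 4.3: let `H₁, H₂` carry polarizable weight-0 `ℚ`-Hodge structures, with `H₂`
having no nonzero rational vector of type `(0,0)`.  If `u ∈ H₁` is rational of type
`(0,0)`, `ε ∈ ℂ ⊗ H₂`, the `u_j ∈ H₁ ⊗ H₂` are rational of type `(0,0)` and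
`u ⊗ ε − Σ λ_j·u_j ∈ F¹ + 2πi·(H₁⊗H₂)_ℚ`, then `u ⊗ ε ∈ F¹ + 2πi·(H₁⊗H₂)_ℚ`. -/
theorem hodge_lemma_ext_vanishing
    (H₁ H₂ : Type*)
    [AddCommGroup H₁] [Module ℚ H₁] [FiniteDimensional ℚ H₁]
    [AddCommGroup H₂] [Module ℚ H₂] [FiniteDimensional ℚ H₂]
    (P₁ : ℤ → Submodule ℂ (ℂ ⊗[ℚ] H₁)) (P₂ : ℤ → Submodule ℂ (ℂ ⊗[ℚ] H₂))
    (hind₁ : iSupIndep P₁) (hsup₁ : (⨆ p, P₁ p) = ⊤)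
    (hfin₁ : {p : ℤ | P₁ p ≠ ⊥}.Finite)
    (hconj₁ : ∀ p, (P₁ p).map (sigmaQ H₁) = P₁ (-p))
    (hind₂ : iSupIndep P₂) (hsup₂ : (⨆ p, P₂ p) = ⊤)
    (hfin₂ : {p : ℤ | P₂ p ≠ ⊥}.Finite)
    (hconj₂ : ∀ p, (P₂ p).map (sigmaQ H₂) = P₂ (-p))
    (hpol₁ : IsPolarizableWeightZero H₁ P₁)
    (hpol₂ : IsPolarizableWeightZero H₂ P₂)
    (hH₂ : ∀ x : H₂, ((1 : ℂ) ⊗ₜ x : ℂ ⊗[ℚ] H₂) ∈ P₂ 0 → x = 0)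
    (u : H₁) (hu : ((1 : ℂ) ⊗ₜ u : ℂ ⊗[ℚ] H₁) ∈ P₁ 0)
    (ε : ℂ ⊗[ℚ] H₂)
    (r : ℕ) (lam : Fin r → ℂ) (uj : Fin r → H₁ ⊗[ℚ] H₂)
    (huj : ∀ j, distribQ H₁ H₂ ((1 : ℂ) ⊗ₜ uj j) ∈
      ⨆ q : ℤ, tensorSub (P₁ q) (P₂ (-q)))
    (hmem : MemF1PlusLattice H₁ H₂ P₁ P₂
      ((((1 : ℂ) ⊗ₜ u : ℂ ⊗[ℚ] H₁) ⊗ₜ[ℂ] ε) -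
        ∑ j, lam j • distribQ H₁ H₂ ((1 : ℂ) ⊗ₜ uj j))) :
    MemF1PlusLattice H₁ H₂ P₁ P₂ (((1 : ℂ) ⊗ₜ u : ℂ ⊗[ℚ] H₁) ⊗ₜ[ℂ] ε) := by
  by_cases hu0 : ((1 : ℂ) ⊗ₜ u : ℂ ⊗[ℚ] H₁) = 0
  · exact ⟨0, Submodule.zero_mem _, 0, by simp [hu0]⟩
  obtain ⟨f, g, hfg, hfu, hf⟩ := hpol₁.exists_functional hu hu0
  have hkill (j : Fin r) :
      contractFst (ℂ ⊗[ℚ] H₂) f (distribQ H₁ H₂ ((1 : ℂ) ⊗ₜ uj j)) = 0 := by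
    have h := tensorSub_le_comap_contractFst (P₂ := P₂) hf 0 (by simpa using huj j)
    rw [Submodule.mem_comap, contractFst_distribQ hfg] at h
    rw [contractFst_distribQ hfg, hH₂ _ h, TensorProduct.tmul_zero]
  obtain ⟨x, hx, w, hw⟩ := hmem
  have hε := congrArg (contractFst (ℂ ⊗[ℚ] H₂) f) hw
  simp only [map_sub, map_sum, map_smul, map_add, hkill, smul_zero, Finset.sum_const_zero,
    sub_zero, contractFst_tmul, hfu, one_smul, contractFst_distribQ hfg] at hε
  refine ⟨((1 : ℂ) ⊗ₜ u) ⊗ₜ contractFst (ℂ ⊗[ℚ] H₂) f x, ?_, u ⊗ₜ contractFst H₂ g w, ?_⟩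
  · have hle : (⨆ p : ℤ, ⨆ _ : 1 ≤ p, ⨆ q : ℤ, tensorSub (P₁ q) (P₂ (p - q))) ≤
        (⨆ p : ℤ, ⨆ _ : 1 ≤ p, ⨆ q : ℤ, tensorSub (P₁ q) (P₂ (p - q))).comap
          (TensorProduct.mk ℂ _ _ ((1 : ℂ) ⊗ₜ u) ∘ₗ contractFst (ℂ ⊗[ℚ] H₂) f) := by
      refine iSup₂_le fun p hp y hy => ?_
      have hy' := tensorSub_le_comap_contractFst hf p hy
      refine Submodule.mem_iSup_of_mem p (Submodule.mem_iSup_of_mem hp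
        (Submodule.mem_iSup_of_mem 0 ?_))
      exact Submodule.apply_mem_map₂ _ hu (by simpa using hy')
    exact hle hx
  · rw [distribQ_one_tmul_tmul, ← TensorProduct.tmul_smul, ← TensorProduct.tmul_add, ← hε]
end
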